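/- For every a > 0 and every u ∈ H¹(ℝ³) (square integrable with square integrable gradient) with ‖u‖₂ > 0, the inequality ∫_{ℝ³} u² ln(u²/‖u‖₂²) dx + (3 + (3/2) ln a) ∫_{ℝ³} u² dx ≤ (a/π) ∫_{ℝ³} |∇u|² dx holds. -/

import Mathlib

open Real MeasureTheory


namespace LSI
open Filter Topology Set

noncomputable def gam (t : ℝ) : ℝ := Real.exp (-π * t ^ 2)
noncomputable def Phi (t : ℝ) : ℝ := ∫ s in (0:ℝ)..t, gam s

lemma gam_cont : Continuous gam := by unfold gam; fun_prop
lemma gam_pos (t : ℝ) : 0 < gam t := Real.exp_pos _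

lemma Phi_strict (t : ℝ) : HasStrictDerivAt Phi (gam t) t :=
  intervalIntegral.integral_hasStrictDerivAt_right (gam_cont.intervalIntegrable _ _)
    (gam_cont.stronglyMeasurableAtFilter _ _) gam_cont.continuousAt

lemma Phi_mono : StrictMono Phi := by
  apply strictMono_of_deriv_pos
  intro x
  rw [(Phi_strict x).hasDerivAt.deriv]
  exact gam_pos x

lemma Phi_cont : Continuous Phi :=
  continuous_iff_continuousAt.2 fun t => (Phi_strict t).hasDerivAt.continuousAt

noncomputable def mass (R : ℝ) : ℝ := Phi R - Phi (-R)

lemma mass_pos {R : ℝ} (hR : 0 < R) : 0 < mass R :=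
  sub_pos.2 (Phi_mono (by linarith))

lemma mass_tendsto : Tendsto mass atTop (𝓝 1) := by
  have h : Integrable gam := integrable_exp_neg_mul_sq Real.pi_pos
  have h1 := intervalIntegral_tendsto_integral h tendsto_neg_atTop_atBot tendsto_id
  have h2 : ∫ x, gam x = 1 := by
    unfold gam
    rw [integral_gaussian, div_self Real.pi_pos.ne', Real.sqrt_one]
  rw [h2] at h1
  refine h1.congr fun R => ?_
  unfold mass Phi
  rw [intervalIntegral.integral_interval_sub_left] <;>
    first | rfl | exact gam_cont.intervalIntegrable _ _

lemma exists_transport {H h : ℝ → ℝ} (hH : ∀ x, HasDerivAt H (h x) x)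
    (h0 : ∀ x, 0 ≤ H x) (h1 : ∀ x, H x ≤ 1) {R : ℝ} (hR : 0 < R) :
    ∃ T : ℝ → ℝ, ∀ x, |T x| ≤ R ∧ HasDerivAt T (mass R * h x / gam (T x)) x := by
  have hm := mass_pos hR
  have key : ∀ x, ∃ t ∈ Icc (-R) R, Phi t = Phi (-R) + mass R * H x := by
    intro x
    have := intermediate_value_Icc (show -R ≤ R by linarith) Phi_cont.continuousOn
    apply this
    constructor
    · have := mul_nonneg hm.le (h0 x); linarith
    · have := mul_le_mul_of_nonneg_left (h1 x) hm.le
      unfold mass at *; linarith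
  choose T hT hTe using key
  refine ⟨T, fun x => ⟨abs_le.2 ⟨(hT x).1, (hT x).2⟩, ?_⟩⟩
  have hinv := (Phi_strict (T x)).to_local_left_inverse (gam_pos _).ne'
    (g := Function.invFun Phi) (Eventually.of_forall fun y =>
      Function.leftInverse_invFun Phi_mono.injective y)
  have e : T = fun y => Function.invFun Phi (Phi (-R) + mass R * H y) := by
    funext y
    rw [← hTe, Function.leftInverse_invFun Phi_mono.injective]
  have hd : HasDerivAt (fun y => Phi (-R) + mass R * H y) (mass R * h x) x :=
    ((hH x).const_mul _).const_add _
  have h3 := hinv.hasDerivAt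
  rw [hTe] at h3
  have h4 := HasDerivAt.comp x h3 hd
  have h5 : HasDerivAt T ((gam (T x))⁻¹ * (mass R * h x)) x := by
    conv => arg 1; rw [e]
    exact h4
  convert h5 using 1
  field_simp

section oneD

lemma f_cont {f d : ℝ → ℝ} (hd : ∀ x, HasDerivAt f (d x) x) : Continuous f := continuous_iff_continuousAt.2 fun t => (hd t).continuousAt

lemma d_meas {f d : ℝ → ℝ} (hd : ∀ x, HasDerivAt f (d x) x) : Measurable d := by
  have : d = deriv f := by funext x; exact (hd x).deriv.symm
  rw [this]; exact measurable_deriv f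


lemma fd_int {f d : ℝ → ℝ} (hd : ∀ x, HasDerivAt f (d x) x)
    (hf2 : Integrable (fun x => f x ^ 2)) (hd2 : Integrable (fun x => d x ^ 2)) : Integrable (fun x => 2 * f x * d x) := by
  refine (hf2.add hd2).mono'
    (((f_cont hd).measurable.const_mul 2).mul (d_meas hd)).aestronglyMeasurable ?_
  refine Eventually.of_forall fun x => ?_
  simp only [Pi.add_apply, Real.norm_eq_abs]
  rw [abs_le]
  constructor <;> nlinarith [sq_nonneg (f x + d x), sq_nonneg (f x - d x)]

lemma sup_bound {f d : ℝ → ℝ} (hd : ∀ x, HasDerivAt f (d x) x)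
    (hf2 : Integrable (fun x => f x ^ 2)) (hd2 : Integrable (fun x => d x ^ 2)) (x : ℝ) : f x ^ 2 ≤ (∫ y, f y ^ 2) + ∫ y, d y ^ 2 := by
  have hder : ∀ x, HasDerivAt (fun y => f y ^ 2) (2 * f x * d x) x := fun x => by
    simpa using (hd x).fun_pow 2
  have hi := fd_int hd hf2 hd2
  have ht := tendsto_zero_of_hasDerivAt_of_integrableOn_Iic (a := x) (fun y _ => hder y)
    hi.integrableOn hf2.integrableOn
  have he := integral_Iic_of_hasDerivAt_of_tendsto' (a := x) (fun y _ => hder y)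
    hi.integrableOn ht
  rw [sub_zero] at he
  rw [← he, ← integral_add hf2 hd2]
  calc _ ≤ ∫ y in Iic x, (f y ^ 2 + d y ^ 2) := by
        apply integral_mono hi.integrableOn (hf2.add hd2).integrableOn
        intro y
        simp only [Pi.add_apply]
        nlinarith [sq_nonneg (f y - d y)]
    _ ≤ _ := setIntegral_le_integral (hf2.add hd2) (Eventually.of_forall fun y => by
        simp only [Pi.zero_apply]; positivity)

lemma lsi_R {f d : ℝ → ℝ} (hd : ∀ x, HasDerivAt f (d x) x)
    (hf2 : Integrable (fun x => f x ^ 2)) (hd2 : Integrable (fun x => d x ^ 2)) {a : ℝ} (ha : 0 < a) (hM : 0 < ∫ y, f y ^ 2)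
    (hlog : Integrable (fun x => f x ^ 2 * Real.log (f x ^ 2 / ∫ y, f y ^ 2)))
    {R : ℝ} (hR : 0 < R) :
    (∫ x, f x ^ 2 * Real.log (f x ^ 2 / ∫ y, f y ^ 2))
      + (1 + Real.log a / 2 + Real.log (mass R)) * (∫ y, f y ^ 2) ≤ a / π * ∫ y, d y ^ 2 := by
  set M := ∫ y, f y ^ 2 with hMdef
  have hm := mass_pos hR
  have fc := f_cont hd
  have hH : ∀ x, HasDerivAt (fun x => (∫ y in Iic x, f y ^ 2) / M) (f x ^ 2 / M) x := by
    intro x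
    apply HasDerivAt.div_const
    have e : (fun x => ∫ y in Iic x, f y ^ 2)
        = fun x => (∫ y in (0:ℝ)..x, f y ^ 2) + ∫ y in Iic 0, f y ^ 2 := by
      funext x
      rw [← intervalIntegral.integral_Iic_sub_Iic hf2.integrableOn hf2.integrableOn]
      ring
    rw [e]
    apply HasDerivAt.add_const
    exact intervalIntegral.integral_hasDerivAt_right ((fc.pow 2).intervalIntegrable _ _)
      ((fc.pow 2).stronglyMeasurableAtFilter _ _) (fc.pow 2).continuousAt
  have hsq : 0 ≤ᵐ[volume] fun y => f y ^ 2 := Eventually.of_forall fun y => sq_nonneg (f y)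
  obtain ⟨T, hT⟩ := exists_transport hH
    (fun x => div_nonneg (integral_nonneg fun y => sq_nonneg (f y)) hM.le)
    (fun x => (div_le_one hM).2 (setIntegral_le_integral hf2 hsq)) hR
  have Tc : Continuous T := continuous_iff_continuousAt.2 fun t => (hT t).2.continuousAt
  set T' : ℝ → ℝ := fun x => mass R * (f x ^ 2 / M) / gam (T x) with hT'
  have T'c : Continuous T' := by
    apply Continuous.div
    · fun_prop
    · exact gam_cont.comp Tc
    · exact fun x => (gam_pos _).ne'
  have T'0 : ∀ x, 0 ≤ T' x := fun x => by
    have := gam_pos (T x)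
    simp only [hT']; positivity
  set S := M + ∫ y, d y ^ 2
  have hS : ∀ x, f x ^ 2 ≤ S := sup_bound hd hf2 hd2
  have T'b : ∀ x, T' x ≤ mass R * (S / M) / gam R := fun x => by
    have h1 : gam R ≤ gam (T x) := by
      unfold gam
      apply Real.exp_le_exp.2
      have : T x ^ 2 ≤ R ^ 2 := sq_le_sq' (abs_le.1 (hT x).1).1 (abs_le.1 (hT x).1).2
      nlinarith [Real.pi_pos]
    have h2 := gam_pos R
    have h3 := hS x
    have h4 : 0 ≤ S := (sq_nonneg _).trans h3
    simp only [hT']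
    gcongr
  have i1 : Integrable (fun x => f x ^ 2 * T' x) := by
    refine (hf2.mul_const (mass R * (S / M) / gam R)).mono'
      ((fc.pow 2).mul T'c).aestronglyMeasurable (Eventually.of_forall fun x => ?_)
    rw [Real.norm_eq_abs, abs_of_nonneg (mul_nonneg (sq_nonneg _) (T'0 x))]
    exact mul_le_mul_of_nonneg_left (T'b x) (sq_nonneg _)
  have fd := fd_int hd hf2 hd2
  have i2 : Integrable (fun x => 2 * f x * d x * T x) :=
    fd.mul_bdd (c := R) Tc.aestronglyMeasurable (Eventually.of_forall fun x => (hT x).1)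
  have i3 : Integrable (fun x => f x ^ 2 * T x) :=
    hf2.mul_bdd (c := R) Tc.aestronglyMeasurable (Eventually.of_forall fun x => (hT x).1)
  have ibp : ∫ x, (2 * f x * d x * T x + f x ^ 2 * T' x) = 0 := by
    apply integral_eq_zero_of_hasDerivAt_of_integrable (f := fun x => f x ^ 2 * T x) _
      (i2.add i1) i3
    intro x
    have h1 : HasDerivAt (fun y => f y ^ 2) (2 * f x * d x) x := by
      simpa using (hd x).fun_pow 2
    exact h1.mul (hT x).2
  set l := Real.sqrt a
  have hl : 0 < l := Real.sqrt_pos.2 ha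
  have hl2 : l ^ 2 = a := Real.sq_sqrt ha.le
  have hlog_l : Real.log l = Real.log a / 2 := by rw [Real.log_sqrt ha.le]
  have pt : ∀ x, f x ^ 2 * Real.log (f x ^ 2 / M)
      ≤ l * (2 * f x * d x * T x + f x ^ 2 * T' x) + a / π * d x ^ 2
        - (1 + Real.log a / 2 + Real.log (mass R)) * f x ^ 2 := by
    intro x
    have young : 0 ≤ l * (2 * f x * d x * T x) + a / π * d x ^ 2 + π * T x ^ 2 * f x ^ 2 := by
      have : l * (2 * f x * d x * T x) + a / π * d x ^ 2 + π * T x ^ 2 * f x ^ 2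
        = (l * d x + π * T x * f x) ^ 2 / π := by
        rw [← hl2]; field_simp; ring
      rw [this]
      have := Real.pi_pos
      positivity
    by_cases hfx : f x = 0
    · simp only [hfx] at young ⊢
      simp at young ⊢
      exact young
    have hF : 0 < f x ^ 2 := by positivity
    have hg := gam_pos (T x)
    have hT'p : 0 < T' x := by simp only [hT']; positivity
    have e1 : f x ^ 2 / M = T' x * gam (T x) / mass R := by
      simp only [hT']; field_simp
    have e2 : Real.log (f x ^ 2 / M)
        = Real.log (l * T' x) - Real.log a / 2 - π * T x ^ 2 - Real.log (mass R) := by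
      rw [e1, Real.log_div (by positivity) hm.ne', Real.log_mul hT'p.ne' hg.ne',
        Real.log_mul hl.ne' hT'p.ne', hlog_l]
      unfold gam
      rw [Real.log_exp]; ring
    have e3 : Real.log (l * T' x) ≤ l * T' x - 1 := Real.log_le_sub_one_of_pos (by positivity)
    rw [e2]
    have e4 := mul_le_mul_of_nonneg_left e3 hF.le
    nlinarith
  have i4 : Integrable (fun x => l * (2 * f x * d x * T x + f x ^ 2 * T' x)) :=
    (i2.add i1).const_mul l
  have i5 := hd2.const_mul (a / π)
  have i6 := hf2.const_mul (1 + Real.log a / 2 + Real.log (mass R))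
  have fin := integral_mono hlog ((i4.add i5).sub i6) pt
  rw [integral_sub' (i4.add i5) i6, integral_add' i4 i5, integral_const_mul, integral_const_mul,
    integral_const_mul, ibp] at fin
  linarith

lemma lsi_one {f d : ℝ → ℝ} (hd : ∀ x, HasDerivAt f (d x) x)
    (hf2 : Integrable (fun x => f x ^ 2)) (hd2 : Integrable (fun x => d x ^ 2)) {a : ℝ} (ha : 0 < a) (hM : 0 < ∫ y, f y ^ 2)
    (hlog : Integrable (fun x => f x ^ 2 * Real.log (f x ^ 2 / ∫ y, f y ^ 2))) :
    (∫ x, f x ^ 2 * Real.log (f x ^ 2 / ∫ y, f y ^ 2))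
      + (1 + Real.log a / 2) * (∫ y, f y ^ 2) ≤ a / π * ∫ y, d y ^ 2 := by
  have h1 : Tendsto (fun R => (∫ x, f x ^ 2 * Real.log (f x ^ 2 / ∫ y, f y ^ 2))
      + (1 + Real.log a / 2 + Real.log (mass R)) * (∫ y, f y ^ 2)) atTop
      (𝓝 ((∫ x, f x ^ 2 * Real.log (f x ^ 2 / ∫ y, f y ^ 2))
      + (1 + Real.log a / 2 + Real.log 1) * (∫ y, f y ^ 2))) :=
    (((mass_tendsto.log one_ne_zero).const_add _).mul_const _).const_add _
  rw [Real.log_one, add_zero] at h1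
  refine le_of_tendsto h1 ?_
  filter_upwards [eventually_gt_atTop 0] with R hR
  exact lsi_R hd hf2 hd2 ha hM hlog hR

/-- pointwise Gibbs bound, upper bound for the logarithm. -/
lemma log_le_bound {f d : ℝ → ℝ} (hd : ∀ x, HasDerivAt f (d x) x)
    (hf2 : Integrable (fun x => f x ^ 2)) (hd2 : Integrable (fun x => d x ^ 2)) (hM : 0 < ∫ y, f y ^ 2) (x : ℝ) :
    f x ^ 2 * Real.log (f x ^ 2 / ∫ y, f y ^ 2)
      ≤ f x ^ 2 * ((∫ y, d y ^ 2) / ∫ y, f y ^ 2) := by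
  by_cases hfx : f x = 0
  · simp [hfx]
  have hF : 0 < f x ^ 2 := by positivity
  apply mul_le_mul_of_nonneg_left _ hF.le
  have h1 := Real.log_le_sub_one_of_pos (div_pos hF hM)
  have h2 := div_le_div_of_nonneg_right (sup_bound hd hf2 hd2 x) hM.le
  rw [add_div, div_self hM.ne'] at h2
  linarith

lemma gibbs_pt {F M k : ℝ} (hF : 0 ≤ F) (hM : 0 < M) (hk : 0 ≤ k) (hFk : F ≠ 0 → k ≠ 0) :
    F * Real.log k ≤ F * Real.log (F / M) + (k * M - F) := by
  rcases hF.eq_or_lt with h | h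
  · rw [← h]; simp; positivity
  have hk' : 0 < k := lt_of_le_of_ne hk (Ne.symm (hFk h.ne'))
  have h1 := Real.log_le_sub_one_of_pos (show 0 < k * M / F by positivity)
  have h2 : Real.log (k * M / F) = Real.log k - Real.log (F / M) := by
    rw [← Real.log_div hk'.ne' (by positivity)]; congr 1; field_simp
  rw [h2] at h1
  have h3 := mul_le_mul_of_nonneg_left h1 h.le
  have h4 : F * (k * M / F - 1) = k * M - F := by field_simp
  rw [h4] at h3
  linarith


lemma f_zero_of {f d : ℝ → ℝ} (hd : ∀ x, HasDerivAt f (d x) x)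
    (hf2 : Integrable (fun x => f x ^ 2)) (hM : ¬ 0 < ∫ y, f y ^ 2) : ∀ x, f x ^ 2 = 0 := by
  have h0 : ∫ y, f y ^ 2 = 0 :=
    le_antisymm (not_lt.1 hM) (integral_nonneg fun y => sq_nonneg (f y))
  have h1 := (integral_eq_zero_iff_of_nonneg (fun y => sq_nonneg (f y)) hf2).1 h0
  have h2 := Continuous.ae_eq_iff_eq (μ := volume) ((f_cont hd).pow 2) continuous_const |>.1 h1
  exact fun x => congrFun h2 x


lemma k_int {k : ℝ → ℝ} (hk : Measurable k) (hk0 : ∀ x, 0 ≤ k x)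
    (hk1 : ∫⁻ x, ENNReal.ofReal (k x) ≤ 1) : Integrable k ∧ ∫ x, k x ≤ 1 := by
  have hi : Integrable k := by
    refine ⟨hk.aestronglyMeasurable, ?_⟩
    rw [hasFiniteIntegral_iff_ofReal (Eventually.of_forall hk0)]
    exact hk1.trans_lt ENNReal.one_lt_top
  refine ⟨hi, ?_⟩
  rw [integral_eq_lintegral_of_nonneg_ae (Eventually.of_forall hk0) hk.aestronglyMeasurable]
  exact ENNReal.toReal_le_of_le_ofReal zero_le_one (by simpa using hk1)

lemma pos_part {f d : ℝ → ℝ} (hd : ∀ x, HasDerivAt f (d x) x)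
    (hf2 : Integrable (fun x => f x ^ 2)) (hd2 : Integrable (fun x => d x ^ 2))
    {k : ℝ → ℝ} (hk : Measurable k) (hk0 : ∀ x, 0 ≤ k x)
    (hk1 : ∫⁻ x, ENNReal.ofReal (k x) ≤ 1) (hfk : ∀ᵐ x, f x ^ 2 ≠ 0 → k x ≠ 0) : ∫⁻ x, ENNReal.ofReal (f x ^ 2 * Real.log (k x))
    ≤ ENNReal.ofReal ((∫ y, f y ^ 2) + ∫ y, d y ^ 2) := by
  by_cases hM : 0 < ∫ y, f y ^ 2
  · obtain ⟨ki, k1⟩ := k_int hk hk0 hk1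
    set M := ∫ y, f y ^ 2
    have hG : 0 ≤ ∫ y, d y ^ 2 := integral_nonneg fun y => sq_nonneg (d y)
    have i : Integrable (fun x => f x ^ 2 * ((∫ y, d y ^ 2) / M) + k x * M) :=
      (hf2.mul_const _).add (ki.mul_const M)
    calc _ ≤ ∫⁻ x, ENNReal.ofReal (f x ^ 2 * ((∫ y, d y ^ 2) / M) + k x * M) := by
          apply lintegral_mono_ae
          filter_upwards [hfk] with x hx
          apply ENNReal.ofReal_le_ofReal
          have h1 := gibbs_pt (sq_nonneg (f x)) hM (hk0 x) hx
          have h2 := log_le_bound hd hf2 hd2 hM x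
          have h3 := sq_nonneg (f x)
          linarith
      _ = ENNReal.ofReal (∫ x, (f x ^ 2 * ((∫ y, d y ^ 2) / M) + k x * M)) := by
          rw [ofReal_integral_eq_lintegral_ofReal i]
          exact Eventually.of_forall fun x => add_nonneg (by positivity)
            (mul_nonneg (hk0 x) hM.le)
      _ ≤ _ := by
          apply ENNReal.ofReal_le_ofReal
          rw [integral_add (hf2.mul_const _) (ki.mul_const M), integral_mul_const,
            integral_mul_const]
          have : M * ((∫ y, d y ^ 2) / M) = ∫ y, d y ^ 2 := by field_simp
          change M * ((∫ y, d y ^ 2) / M) + _ ≤ _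
          rw [this]
          nlinarith
  · have := f_zero_of hd hf2 hM
    simp [this]

lemma lsi_k {f d : ℝ → ℝ} (hd : ∀ x, HasDerivAt f (d x) x)
    (hf2 : Integrable (fun x => f x ^ 2)) (hd2 : Integrable (fun x => d x ^ 2))
    {k : ℝ → ℝ} (hk : Measurable k) (hk0 : ∀ x, 0 ≤ k x)
    (hk1 : ∫⁻ x, ENNReal.ofReal (k x) ≤ 1) (hfk : ∀ᵐ x, f x ^ 2 ≠ 0 → k x ≠ 0) {a : ℝ} (ha : 0 < a) (hlog : Integrable (fun x => f x ^ 2 * Real.log (k x))) :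
    (∫ x, f x ^ 2 * Real.log (k x))
      + (1 + Real.log a / 2) * (∫ y, f y ^ 2) ≤ a / π * ∫ y, d y ^ 2 := by
  by_cases hM : 0 < ∫ y, f y ^ 2
  · obtain ⟨ki, k1⟩ := k_int hk hk0 hk1
    have fc := f_cont hd
    set M := ∫ y, f y ^ 2 with hMd
    have gi : ∀ᵐ x, f x ^ 2 * Real.log (k x) ≤ f x ^ 2 * Real.log (f x ^ 2 / M)
        + (k x * M - f x ^ 2) := by
      filter_upwards [hfk] with x hx
      exact gibbs_pt (sq_nonneg (f x)) hM (hk0 x) hx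
    have ii : Integrable (fun x => k x * M - f x ^ 2) := (ki.mul_const M).sub hf2
    have li : Integrable (fun x => f x ^ 2 * Real.log (f x ^ 2 / M)) := by
      refine integrable_of_le_of_le (g₁ := fun x => f x ^ 2 * Real.log (k x)
          - (k x * M - f x ^ 2)) (g₂ := fun x => f x ^ 2 * ((∫ y, d y ^ 2) / M)) ?_ ?_ ?_
        (hlog.sub ii) (hf2.mul_const _)
      · exact ((fc.measurable.pow_const 2).mul
          (Real.measurable_log.comp ((fc.measurable.pow_const 2).div_const M))).aestronglyMeasurable
      · filter_upwards [gi] with x hx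
        linarith
      · exact Eventually.of_forall fun x => log_le_bound hd hf2 hd2 hM x
    have h1 := lsi_one hd hf2 hd2 ha hM li
    have h2 := integral_mono_ae hlog (li.add ii) gi
    simp only [Pi.add_apply] at h2
    rw [integral_add li ii, integral_sub (ki.mul_const M) hf2, integral_mul_const] at h2
    rw [← hMd] at h1 h2
    nlinarith
  · have := f_zero_of hd hf2 hM
    simp only [this]
    simp only [zero_mul, integral_zero, mul_zero, add_zero]
    have := Real.pi_pos
    exact mul_nonneg (by positivity) (integral_nonneg fun y => sq_nonneg (d y))

end oneD
end LSI


namespace LSI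
open Filter Topology Set

section dir
variable {α : Type*} [MeasurableSpace α] {ν : Measure α} [SFinite ν]
  {U D k : α × ℝ → ℝ}

lemma dir_pos (hder : ∀ w t, HasDerivAt (fun s => U (w, s)) (D (w, t)) t)
    (hUm : Measurable U)
    (hU : Integrable (fun p => U p ^ 2) (ν.prod volume))
    (hD : Integrable (fun p => D p ^ 2) (ν.prod volume))
    (hk : Measurable k) (hk0 : ∀ p, 0 ≤ k p)
    (hk1 : ∀ w, ∫⁻ t, ENNReal.ofReal (k (w, t)) ≤ 1)
    (hUk : ∀ᵐ p ∂(ν.prod volume), U p ^ 2 ≠ 0 → k p ≠ 0) :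
    ∫⁻ p, ENNReal.ofReal (U p ^ 2 * Real.log (k p)) ∂(ν.prod volume) ≠ ⊤ := by
  have hm : Measurable (fun p => ENNReal.ofReal (U p ^ 2 * Real.log (k p))) :=
    ENNReal.measurable_ofReal.comp ((hUm.pow_const 2).mul (Real.measurable_log.comp hk))
  rw [lintegral_prod _ hm.aemeasurable]
  have h1 : ∫⁻ w, (∫⁻ t, ENNReal.ofReal (U (w, t) ^ 2 * Real.log (k (w, t)))) ∂ν
      ≤ ∫⁻ w, ENNReal.ofReal ((∫ t, U (w, t) ^ 2) + ∫ t, D (w, t) ^ 2) ∂ν := by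
    apply lintegral_mono_ae
    filter_upwards [hU.prod_right_ae, hD.prod_right_ae, Measure.ae_ae_of_ae_prod hUk]
      with w h1 h2 h3
    exact pos_part (hder w) h1 h2 (hk.comp measurable_prodMk_left) (fun t => hk0 _) (hk1 w) h3
  refine (h1.trans_lt ?_).ne
  have hi := hU.integral_prod_left.add hD.integral_prod_left
  have := hi.lintegral_lt_top
  exact this

lemma dir_lsi (hder : ∀ w t, HasDerivAt (fun s => U (w, s)) (D (w, t)) t)
    (hU : Integrable (fun p => U p ^ 2) (ν.prod volume))
    (hD : Integrable (fun p => D p ^ 2) (ν.prod volume))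
    (hk : Measurable k) (hk0 : ∀ p, 0 ≤ k p)
    (hk1 : ∀ w, ∫⁻ t, ENNReal.ofReal (k (w, t)) ≤ 1)
    (hUk : ∀ᵐ p ∂(ν.prod volume), U p ^ 2 ≠ 0 → k p ≠ 0)
    {a : ℝ} (ha : 0 < a)
    (hlog : Integrable (fun p => U p ^ 2 * Real.log (k p)) (ν.prod volume)) :
    (∫ p, U p ^ 2 * Real.log (k p) ∂(ν.prod volume))
      + (1 + Real.log a / 2) * (∫ p, U p ^ 2 ∂(ν.prod volume))
      ≤ a / π * ∫ p, D p ^ 2 ∂(ν.prod volume) := by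
  rw [integral_prod _ hlog, integral_prod _ hU, integral_prod _ hD, ← integral_const_mul,
    ← integral_const_mul, ← integral_add hlog.integral_prod_left
      (hU.integral_prod_left.const_mul _)]
  apply integral_mono_ae (hlog.integral_prod_left.add (hU.integral_prod_left.const_mul _))
    (hD.integral_prod_left.const_mul _)
  filter_upwards [hU.prod_right_ae, hD.prod_right_ae, Measure.ae_ae_of_ae_prod hUk,
    hlog.prod_right_ae] with w h1 h2 h3 h4
  exact lsi_k (hder w) h1 h2 (hk.comp measurable_prodMk_left) (fun t => hk0 _) (hk1 w) h3 ha h4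

end dir

section dir2
variable {Ω α : Type*} [MeasurableSpace Ω] [MeasurableSpace α] {μ : Measure Ω} {ν : Measure α}
  [SFinite ν] {U D k : Ω → ℝ}

lemma dir2 (e : Ω ≃ᵐ α × ℝ) (he : MeasurePreserving e μ (ν.prod volume))
    (hder : ∀ w t, HasDerivAt (fun s => U (e.symm (w, s))) (D (e.symm (w, t))) t)
    (hUm : Measurable U)
    (hU : Integrable (fun p => U p ^ 2) μ)
    (hD : Integrable (fun p => D p ^ 2) μ)
    (hk : Measurable k) (hk0 : ∀ p, 0 ≤ k p)
    (hk1 : ∀ w, ∫⁻ t, ENNReal.ofReal (k (e.symm (w, t))) ≤ 1)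
    (hUk : ∀ᵐ p ∂μ, U p ^ 2 ≠ 0 → k p ≠ 0) :
    ∫⁻ p, ENNReal.ofReal (U p ^ 2 * Real.log (k p)) ∂μ ≠ ⊤ ∧
    ∀ {a : ℝ} (_ : 0 < a) (_ : Integrable (fun p => U p ^ 2 * Real.log (k p)) μ),
    (∫ p, U p ^ 2 * Real.log (k p) ∂μ)
      + (1 + Real.log a / 2) * (∫ p, U p ^ 2 ∂μ) ≤ a / π * ∫ p, D p ^ 2 ∂μ := by
  have hs : MeasurePreserving e.symm (ν.prod volume) μ := he.symm
  have me := e.symm.measurableEmbedding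
  have tI : ∀ g : Ω → ℝ, Integrable g μ → Integrable (fun p => g (e.symm p)) (ν.prod volume) :=
    fun g hg => (hs.integrable_comp_emb me).2 hg
  have ti : ∀ g : Ω → ℝ, ∫ p, g p ∂μ = ∫ p, g (e.symm p) ∂(ν.prod volume) :=
    fun g => (hs.integral_comp me g).symm
  have hUk' : ∀ᵐ p ∂(ν.prod volume), U (e.symm p) ^ 2 ≠ 0 → k (e.symm p) ≠ 0 :=
    hs.quasiMeasurePreserving.ae hUk
  constructor
  · rw [← hs.lintegral_comp_emb me]
    exact dir_pos (U := fun p => U (e.symm p)) (D := fun p => D (e.symm p))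
      (k := fun p => k (e.symm p)) hder (hUm.comp e.symm.measurable) (tI _ hU) (tI _ hD)
      (hk.comp e.symm.measurable) (fun p => hk0 _) hk1 hUk'
  · intro a ha hl
    rw [ti, ti (fun p => U p ^ 2), ti (fun p => D p ^ 2)]
    exact dir_lsi (U := fun p => U (e.symm p)) (D := fun p => D (e.symm p))
      (k := fun p => k (e.symm p)) hder (tI _ hU) (tI _ hD)
      (hk.comp e.symm.measurable) (fun p => hk0 _) hk1 hUk' ha (tI _ hl)
end dir2

lemma norm_le_one (g : ℝ → ℝ) (hg : ∀ t, 0 ≤ g t) :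
    ∫⁻ t, ENNReal.ofReal (g t / ∫ s, g s) ≤ 1 := by
  by_cases h : Integrable g
  · have hi : 0 ≤ ∫ s, g s := integral_nonneg hg
    rw [← ofReal_integral_eq_lintegral_ofReal (h.div_const _)
      (Eventually.of_forall fun t => div_nonneg (hg t) hi), integral_div]
    exact ENNReal.ofReal_le_one.2 (div_self_le_one _)
  · rw [integral_undef h]; simp

/-- If the slice integral vanishes then so does the function, almost everywhere. -/
lemma ae_slice {β γ : Type*} [MeasurableSpace β] [MeasurableSpace γ] {μ : Measure β}
    {ν : Measure γ} [SFinite μ] [SFinite ν] {F : β × γ → ℝ} (hF : Integrable F (μ.prod ν))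
    (hFm : Measurable F) (h0 : ∀ p, 0 ≤ F p) :
    ∀ᵐ p ∂(μ.prod ν), F p ≠ 0 → ∫ x, F (x, p.2) ∂μ ≠ 0 := by
  have hm : Measurable (fun z => ∫ x, F (x, z) ∂μ) := by
    have : StronglyMeasurable (Function.uncurry fun x z => F (x, z)) := hFm.stronglyMeasurable
    exact (this.integral_prod_left).measurable
  have hs : MeasurableSet {p : β × γ | F p ≠ 0 → ∫ x, F (x, p.2) ∂μ ≠ 0} := by
    have e : {p : β × γ | F p ≠ 0 → ∫ x, F (x, p.2) ∂μ ≠ 0}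
      = F ⁻¹' {0} ∪ (fun p : β × γ => ∫ x, F (x, p.2) ∂μ) ⁻¹' {0}ᶜ := by
      ext p; simp; tauto
    rw [e]
    exact (hFm (measurableSet_singleton 0)).union
      ((hm.comp measurable_snd) (measurableSet_singleton 0).compl)
  have hsw := Measure.measurePreserving_swap (μ := ν) (ν := μ)
  rw [← hsw.map_eq, ae_map_iff measurable_swap.aemeasurable hs]
  refine (Measure.ae_prod_iff_ae_ae (measurable_swap hs)).2 ?_
  filter_upwards [hF.prod_left_ae] with z hz
  by_cases hi : ∫ x, F (x, z) ∂μ = 0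
  · have := (integral_eq_zero_iff_of_nonneg (fun x => h0 _) hz).1 hi
    filter_upwards [this] with x hx
    intro h; exact absurd hx h
  · exact Eventually.of_forall fun x _ => hi

lemma int_of_sum {Ω : Type*} [MeasurableSpace Ω] {μ : Measure Ω} {A B C S : Ω → ℝ}
    (hA : Measurable A) (hS : Integrable S μ)
    (hs : S =ᵐ[μ] fun p => A p + B p + C p)
    (pA : ∫⁻ p, ENNReal.ofReal (A p) ∂μ ≠ ⊤) (pB : ∫⁻ p, ENNReal.ofReal (B p) ∂μ ≠ ⊤)
    (pC : ∫⁻ p, ENNReal.ofReal (C p) ∂μ ≠ ⊤) (hB : Measurable B) (hC : Measurable C) :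
    Integrable A μ := by
  have key : ∀ X : Ω → ℝ, Measurable X → ∫⁻ p, ENNReal.ofReal (X p) ∂μ ≠ ⊤ →
      Integrable (fun p => max (X p) 0) μ := by
    intro X hX h
    refine ⟨(hX.max measurable_const).aestronglyMeasurable, ?_⟩
    rw [hasFiniteIntegral_iff_ofReal (Eventually.of_forall fun p => le_max_right (X p) 0)]
    simpa [ENNReal.ofReal_max] using h.lt_top
  refine integrable_of_le_of_le (g₁ := fun p => S p - max (B p) 0 - max (C p) 0)
    (g₂ := fun p => max (A p) 0) hA.aestronglyMeasurable ?_
    (Eventually.of_forall fun p => le_max_left _ _)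
    ((hS.sub (key B hB pB)).sub (key C hC pC)) (key A hA pA)
  filter_upwards [hs] with p hp
  rw [hp]
  have := le_max_left (B p) 0
  have := le_max_left (C p) 0
  linarith

/-- The inequality on `ℝ × ℝ × ℝ`. -/
lemma lsi_three {U D₁ D₂ D₃ : ℝ × ℝ × ℝ → ℝ}
    (h₁ : ∀ x y z, HasDerivAt (fun s => U (s, y, z)) (D₁ (x, y, z)) x)
    (h₂ : ∀ x y z, HasDerivAt (fun s => U (x, s, z)) (D₂ (x, y, z)) y)
    (h₃ : ∀ x y z, HasDerivAt (fun s => U (x, y, s)) (D₃ (x, y, z)) z)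
    (hUm : Measurable U) (hU : Integrable (fun p => U p ^ 2))
    (i₁ : Integrable (fun p => D₁ p ^ 2)) (i₂ : Integrable (fun p => D₂ p ^ 2))
    (i₃ : Integrable (fun p => D₃ p ^ 2))
    (hN : 0 < ∫ p, U p ^ 2) {a : ℝ} (ha : 0 < a)
    (hlog : Integrable (fun p => U p ^ 2 * Real.log (U p ^ 2 / ∫ q, U q ^ 2))) :
    (∫ p, U p ^ 2 * Real.log (U p ^ 2 / ∫ q, U q ^ 2))
      + 3 * (1 + Real.log a / 2) * (∫ p, U p ^ 2)
      ≤ a / π * ((∫ p, D₁ p ^ 2) + (∫ p, D₂ p ^ 2) + ∫ p, D₃ p ^ 2) := by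
  set N := ∫ q, U q ^ 2 with hNd
  have hFm : Measurable (fun p => U p ^ 2) := hUm.pow_const 2
  set G : ℝ × ℝ → ℝ := fun q => ∫ x, U (x, q) ^ 2 with hG
  set K : ℝ → ℝ := fun z => ∫ y, G (y, z) with hK
  have hGm : Measurable G := by
    have : StronglyMeasurable (Function.uncurry fun (x : ℝ) (q : ℝ × ℝ) => U (x, q) ^ 2) :=
      hFm.stronglyMeasurable
    exact (this.integral_prod_left).measurable
  have hKm : Measurable K := by
    have : StronglyMeasurable (Function.uncurry fun (y z : ℝ) => G (y, z)) :=
      hGm.stronglyMeasurable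
    exact (this.integral_prod_left).measurable
  have G0 : ∀ q, 0 ≤ G q := fun q => integral_nonneg fun x => sq_nonneg _
  have K0 : ∀ z, 0 ≤ K z := fun z => integral_nonneg fun y => G0 _
  have hU' : Integrable (fun p => U p ^ 2) ((volume : Measure ℝ).prod (volume : Measure (ℝ × ℝ))) :=
    hU
  have Gi : Integrable G ((volume : Measure ℝ).prod (volume : Measure ℝ)) :=
    hU'.integral_prod_right
  have KN : ∫ z, K z = N := by
    have e1 : N = ∫ q, G q := integral_prod_symm _ hU'
    rw [e1]
    exact (integral_prod_symm _ Gi).symm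
  have ae1 : ∀ᵐ p : ℝ × ℝ × ℝ, U p ^ 2 ≠ 0 → G p.2 ≠ 0 :=
    ae_slice hU' hFm (fun p => sq_nonneg _)
  have ae2 : ∀ᵐ q : ℝ × ℝ, G q ≠ 0 → K q.2 ≠ 0 := ae_slice Gi hGm G0
  have ae2' : ∀ᵐ p : ℝ × ℝ × ℝ, G p.2 ≠ 0 → K p.2.2 ≠ 0 :=
    (Measure.quasiMeasurePreserving_snd (μ := (volume : Measure ℝ))
      (ν := (volume : Measure (ℝ × ℝ)))).ae ae2
  -- the three conditional densities
  have A := dir2 (μ := (volume : Measure (ℝ × ℝ × ℝ))) (ν := (volume : Measure (ℝ × ℝ)))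
    (U := U) (D := D₁) (k := fun p => U p ^ 2 / G p.2)
    (MeasurableEquiv.prodComm : ℝ × ℝ × ℝ ≃ᵐ (ℝ × ℝ) × ℝ)
    (Measure.measurePreserving_swap) (fun w t => h₁ t w.1 w.2) hUm hU i₁
    (hFm.div (hGm.comp measurable_snd)) (fun p => div_nonneg (sq_nonneg _) (G0 _))
    (fun w => norm_le_one (fun t => U (t, w) ^ 2) fun t => sq_nonneg _)
    (by filter_upwards [ae1] with p hp h using div_ne_zero h (hp h))
  have B := dir2 (μ := (volume : Measure (ℝ × ℝ × ℝ))) (ν := (volume : Measure (ℝ × ℝ)))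
    (U := U) (D := D₂) (k := fun p => G p.2 / K p.2.2)
    (((MeasurableEquiv.refl ℝ).prodCongr MeasurableEquiv.prodComm).trans
      MeasurableEquiv.prodAssoc.symm : ℝ × ℝ × ℝ ≃ᵐ (ℝ × ℝ) × ℝ)
    (((MeasurePreserving.id volume).prod Measure.measurePreserving_swap).trans
      (measurePreserving_prodAssoc volume volume volume).symm)
    (fun w t => h₂ w.1 t w.2) hUm hU i₂
    ((hGm.comp measurable_snd).div (hKm.comp (measurable_snd.comp measurable_snd)))
    (fun p => div_nonneg (G0 _) (K0 _))
    (fun w => norm_le_one (fun t => G (t, w.2)) fun t => G0 _)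
    (by filter_upwards [ae1, ae2'] with p hp hq h using div_ne_zero (hp h) (hq (hp h)))
  have C := dir2 (μ := (volume : Measure (ℝ × ℝ × ℝ))) (ν := (volume : Measure (ℝ × ℝ)))
    (U := U) (D := D₃) (k := fun p => K p.2.2 / N)
    (MeasurableEquiv.prodAssoc.symm : ℝ × ℝ × ℝ ≃ᵐ (ℝ × ℝ) × ℝ)
    ((measurePreserving_prodAssoc volume volume volume).symm)
    (fun w t => h₃ w.1 w.2 t) hUm hU i₃
    ((hKm.comp (measurable_snd.comp measurable_snd)).div_const N)
    (fun p => div_nonneg (K0 _) hN.le)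
    (fun w => by rw [← KN]; exact norm_le_one K K0)
    (by filter_upwards [ae1, ae2'] with p hp hq h using div_ne_zero (hq (hp h)) hN.ne')
  obtain ⟨A1, A2⟩ := A
  obtain ⟨B1, B2⟩ := B
  obtain ⟨C1, C2⟩ := C
  have mA : Measurable (fun p : ℝ × ℝ × ℝ => U p ^ 2 * Real.log (U p ^ 2 / G p.2)) :=
    hFm.mul (Real.measurable_log.comp (hFm.div (hGm.comp measurable_snd)))
  have mB : Measurable (fun p : ℝ × ℝ × ℝ => U p ^ 2 * Real.log (G p.2 / K p.2.2)) :=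
    hFm.mul (Real.measurable_log.comp
      ((hGm.comp measurable_snd).div (hKm.comp (measurable_snd.comp measurable_snd))))
  have mC : Measurable (fun p : ℝ × ℝ × ℝ => U p ^ 2 * Real.log (K p.2.2 / N)) :=
    hFm.mul (Real.measurable_log.comp
      ((hKm.comp (measurable_snd.comp measurable_snd)).div_const N))
  have hsum : (fun p => U p ^ 2 * Real.log (U p ^ 2 / N)) =ᵐ[volume]
      fun p => U p ^ 2 * Real.log (U p ^ 2 / G p.2) + U p ^ 2 * Real.log (G p.2 / K p.2.2)
        + U p ^ 2 * Real.log (K p.2.2 / N) := by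
    filter_upwards [ae1, ae2'] with p hp hq
    by_cases h : U p ^ 2 = 0
    · simp [h]
    · have g := hp h
      have kk := hq g
      rw [Real.log_div h hN.ne', Real.log_div h g, Real.log_div g kk, Real.log_div kk hN.ne']
      ring
  have iA := int_of_sum mA hlog hsum A1 B1 C1 mB mC
  have iB := int_of_sum mB hlog (B := fun p => U p ^ 2 * Real.log (U p ^ 2 / G p.2))
    (C := fun p => U p ^ 2 * Real.log (K p.2.2 / N))
    (hsum.trans (Eventually.of_forall fun p => by ring)) B1 A1 C1 mA mC
  have iC := int_of_sum mC hlog (B := fun p => U p ^ 2 * Real.log (U p ^ 2 / G p.2))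
    (C := fun p => U p ^ 2 * Real.log (G p.2 / K p.2.2))
    (hsum.trans (Eventually.of_forall fun p => by ring)) C1 A1 B1 mA mB
  have iAB : Integrable (fun p : ℝ × ℝ × ℝ => U p ^ 2 * Real.log (U p ^ 2 / G p.2)
      + U p ^ 2 * Real.log (G p.2 / K p.2.2)) := iA.add iB
  rw [integral_congr_ae hsum, integral_add iAB iC, integral_add iA iB]
  have a1 := A2 ha iA
  have a2 := B2 ha iB
  have a3 := C2 ha iC
  rw [← hNd] at a1 a2 a3
  linarith

/-- Coordinates. -/
noncomputable def coord : EuclideanSpace ℝ (Fin 3) ≃ᵐ ℝ × ℝ × ℝ :=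
  ((MeasurableEquiv.toLp 2 (Fin 3 → ℝ)).symm.trans
    (MeasurableEquiv.piFinSuccAbove (fun _ : Fin 3 => ℝ) 0)).trans
    ((MeasurableEquiv.refl ℝ).prodCongr MeasurableEquiv.finTwoArrow)

lemma coord_mp : MeasurePreserving coord volume volume :=
  ((EuclideanSpace.volume_preserving_symm_measurableEquiv_toLp (Fin 3)).trans
    (volume_preserving_piFinSuccAbove (fun _ : Fin 3 => ℝ) 0)).trans
    ((MeasurePreserving.id volume).prod (volume_preserving_finTwoArrow ℝ))

lemma coord_symm (x y z : ℝ) : coord.symm (x, y, z) = !₂[x, y, z] := by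
  rw [MeasurableEquiv.symm_apply_eq]
  rfl

lemma grad_sq (u : EuclideanSpace ℝ (Fin 3) → ℝ) (x : EuclideanSpace ℝ (Fin 3)) :
    ‖gradient u x‖ ^ 2 = fderiv ℝ u x (EuclideanSpace.single 0 1) ^ 2
      + fderiv ℝ u x (EuclideanSpace.single 1 1) ^ 2
      + fderiv ℝ u x (EuclideanSpace.single 2 1) ^ 2 := by
  have h : ∀ i, gradient u x i = fderiv ℝ u x (EuclideanSpace.single i 1) := by
    intro i
    have := InnerProductSpace.toDual_symm_apply (𝕜 := ℝ)
      (x := EuclideanSpace.single i (1:ℝ)) (y := fderiv ℝ u x)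
    rw [← this, EuclideanSpace.inner_single_right]
    simp [gradient]
  rw [EuclideanSpace.real_norm_sq_eq, Fin.sum_univ_three, h, h, h]

end LSI

theorem stmt_17 (a : ℝ) (ha : 0 < a) (u : EuclideanSpace ℝ (Fin 3) → ℝ)
    (hdiff : Differentiable ℝ u)
    (hu2 : Integrable (fun x => (u x) ^ 2))
    (hgrad2 : Integrable (fun x => ‖gradient u x‖ ^ 2))
    (hpos : 0 < ∫ x, (u x) ^ 2)
    (hlogint : Integrable (fun x => (u x) ^ 2 * Real.log ((u x) ^ 2 / ∫ y, (u y) ^ 2))) :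
    (∫ x, (u x) ^ 2 * Real.log ((u x) ^ 2 / ∫ y, (u y) ^ 2)) +
        (3 + (3 / 2) * Real.log a) * ∫ x, (u x) ^ 2
      ≤ (a / π) * ∫ x, ‖gradient u x‖ ^ 2 := by
  have hs : MeasurePreserving LSI.coord.symm volume volume := LSI.coord_mp.symm
  have me := LSI.coord.symm.measurableEmbedding
  have tI : ∀ g : EuclideanSpace ℝ (Fin 3) → ℝ, Integrable g →
      Integrable (fun p => g (LSI.coord.symm p)) :=
    fun g hg => (hs.integrable_comp_emb me).2 hg
  have ti : ∀ g : EuclideanSpace ℝ (Fin 3) → ℝ, ∫ p, g (LSI.coord.symm p) = ∫ p, g p :=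
    fun g => hs.integral_comp me g
  have dm : ∀ i : Fin 3, Measurable (fun x => fderiv ℝ u x (EuclideanSpace.single i 1) ^ 2) :=
    fun i => (measurable_fderiv_apply_const ℝ u _).pow_const 2
  have di : ∀ i : Fin 3, Integrable (fun x => fderiv ℝ u x (EuclideanSpace.single i 1) ^ 2) := by
    intro i
    refine hgrad2.mono' (dm i).aestronglyMeasurable (Filter.Eventually.of_forall fun x => ?_)
    rw [Real.norm_eq_abs, abs_of_nonneg (sq_nonneg _), LSI.grad_sq]
    fin_cases i <;> simp <;> nlinarith [sq_nonneg (fderiv ℝ u x (EuclideanSpace.single 0 1)),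
      sq_nonneg (fderiv ℝ u x (EuclideanSpace.single 1 1)),
      sq_nonneg (fderiv ℝ u x (EuclideanSpace.single 2 1))]
  have line : ∀ (v : ℝ → EuclideanSpace ℝ (Fin 3)) (c e : EuclideanSpace ℝ (Fin 3)) (t : ℝ),
      (∀ s, v s = c + s • e) → HasDerivAt (fun s => u (v s)) (fderiv ℝ u (v t) e) t := by
    intro v c e t hv
    have h1 : HasDerivAt v e t := by
      have : v = fun s => c + s • e := funext hv
      rw [this]
      simpa using ((hasDerivAt_id t).smul_const e).const_add c
    exact (hdiff (v t)).hasFDerivAt.comp_hasDerivAt t h1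
  have main := LSI.lsi_three (U := fun p => u (LSI.coord.symm p))
    (D₁ := fun p => fderiv ℝ u (LSI.coord.symm p) (EuclideanSpace.single 0 1))
    (D₂ := fun p => fderiv ℝ u (LSI.coord.symm p) (EuclideanSpace.single 1 1))
    (D₃ := fun p => fderiv ℝ u (LSI.coord.symm p) (EuclideanSpace.single 2 1))
    (fun x y z => line _ !₂[0, y, z] _ x fun s => by
      rw [LSI.coord_symm]; ext i; fin_cases i <;> simp)
    (fun x y z => line _ !₂[x, 0, z] _ y fun s => by
      rw [LSI.coord_symm]; ext i; fin_cases i <;> simp)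
    (fun x y z => line _ !₂[x, y, 0] _ z fun s => by
      rw [LSI.coord_symm]; ext i; fin_cases i <;> simp)
    (hdiff.continuous.measurable.comp LSI.coord.symm.measurable)
    (tI _ hu2) (tI _ (di 0)) (tI _ (di 1)) (tI _ (di 2))
    (by rw [ti (fun x => u x ^ 2)]; exact hpos) ha
    (by rw [ti (fun x => u x ^ 2)]; exact tI _ hlogint)
  rw [ti (fun x => u x ^ 2), ti (fun x => (u x) ^ 2 * Real.log ((u x) ^ 2 / ∫ y, (u y) ^ 2)),
    ti (fun x => fderiv ℝ u x (EuclideanSpace.single 0 1) ^ 2),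
    ti (fun x => fderiv ℝ u x (EuclideanSpace.single 1 1) ^ 2),
    ti (fun x => fderiv ℝ u x (EuclideanSpace.single 2 1) ^ 2)] at main
  have hg : ∫ x, ‖gradient u x‖ ^ 2
      = (∫ x, fderiv ℝ u x (EuclideanSpace.single 0 1) ^ 2)
      + (∫ x, fderiv ℝ u x (EuclideanSpace.single 1 1) ^ 2)
      + ∫ x, fderiv ℝ u x (EuclideanSpace.single 2 1) ^ 2 := by
    simp_rw [LSI.grad_sq]
    have d01 : Integrable (fun x => fderiv ℝ u x (EuclideanSpace.single 0 1) ^ 2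
      + fderiv ℝ u x (EuclideanSpace.single 1 1) ^ 2) := (di 0).add (di 1)
    rw [integral_add d01 (di 2), integral_add (di 0) (di 1)]
  rw [hg]
  linarith
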